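/- For every α > 0, every β with 0 < β < 1 and every t > 0, the following identity holds, expressing the variance of the Riemann–Liouville fractional integral of order α of the generalized fractional counting process of order β: (2/Γ(α)²) ∫_0^t ∫_s^t (t−s)^{α−1}(t−w)^{α−1} [ c₂ s^β/Γ(β+1) + c₁² s^{2β}/Γ(2β+1) + c₁² β w^{2β} B(β, β+1; s/w)/Γ(β+1)² ] dw ds − (c₁ t^{α+β}/Γ(α+β+1))² = (2 c₂ B(β+1, 2α)/(Γ(α)² Γ(β+1) α)) t^{2α+β} + (2 B(2β+1, 2α)/(Γ(α)² Γ(2β+1) α) − 1/Γ(α+β+1)²) c₁² t^{2α+2β} + (2 c₁² β/(Γ(α) Γ(β+1))²) ∫_0^t ∫_s^t (t−s)^{α−1}(t−w)^{α−1} w^{2β} B(β, β+1; s/w) dw ds. -/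

import Mathlib

noncomputable section
open MeasureTheory Real Finset

/-- The incomplete beta function B(a,b;x) = ∫_0^x u^{a−1}(1−u)^{b−1} du. -/
def incBeta (a b x : ℝ) : ℝ := ∫ u in (0 : ℝ)..x, u ^ (a - 1) * (1 - u) ^ (b - 1)

/-- The beta function B(a,b) = B(a,b;1). -/
def betaFn (a b : ℝ) : ℝ := incBeta a b 1

lemma aux_int_sub (α t a b : ℝ) (hα : 0 < α) :
    IntervalIntegrable (fun w => (t - w) ^ (α - 1)) volume a b := by
  have h := (intervalIntegral.intervalIntegrable_rpow' (a := t - a) (b := t - b)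
    (r := α - 1) (by linarith)).comp_sub_left t
  simpa using h

lemma aux_inner (α t s : ℝ) (hα : 0 < α) :
    ∫ w in s..t, (t - w) ^ (α - 1) = (t - s) ^ α / α := by
  rw [intervalIntegral.integral_comp_sub_left (fun x => x ^ (α - 1)),
    integral_rpow (Or.inl (by linarith))]
  simp [Real.zero_rpow hα.ne']

lemma aux_beta (α b t : ℝ) (ht : 0 < t) :
    ∫ s in (0 : ℝ)..t, (t - s) ^ (α - 1) * (t - s) ^ α * s ^ b
      = t ^ (2 * α + b) * betaFn (b + 1) (2 * α) := by
  have h := intervalIntegral.integral_comp_mul_left (a := 0) (b := 1)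
    (fun s => (t - s) ^ (α - 1) * (t - s) ^ α * s ^ b) ht.ne'
  simp only [mul_zero, mul_one, smul_eq_mul] at h
  have h2 : ∫ s in (0 : ℝ)..t, (t - s) ^ (α - 1) * (t - s) ^ α * s ^ b
      = t * ∫ x in (0 : ℝ)..1, (t - t * x) ^ (α - 1) * (t - t * x) ^ α * (t * x) ^ b := by
    rw [h]; field_simp
  rw [h2, betaFn, incBeta, ← intervalIntegral.integral_const_mul,
    ← intervalIntegral.integral_const_mul]
  apply intervalIntegral.integral_congr_Ioo_of_le zero_le_one
  intro u hu
  have hu1 : 0 < 1 - u := by linarith [hu.2]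
  have e : t - t * u = t * (1 - u) := by ring
  simp only
  rw [e, ← Real.rpow_add (mul_pos ht hu1), Real.mul_rpow ht.le hu1.le,
    Real.mul_rpow ht.le hu.1.le]
  have e1 : t ^ (2 * α + b) = t * (t ^ (α - 1 + α) * t ^ b) := by
    rw [← Real.rpow_add ht]
    nth_rewrite 2 [← Real.rpow_one t]
    rw [← Real.rpow_add ht]; congr 1; ring
  rw [e1, show b + 1 - 1 = b by ring, show 2 * α - 1 = α - 1 + α by ring]
  ring

lemma aux_incBeta_cont (β : ℝ) (hβ : 0 < β) :
    ContinuousOn (incBeta β (β + 1)) (Set.Icc 0 1) := by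
  have h : IntervalIntegrable (fun u : ℝ => u ^ (β - 1) * (1 - u) ^ (β + 1 - 1)) volume 0 1 := by
    apply (intervalIntegral.intervalIntegrable_rpow' (by linarith)).mul_continuousOn
    apply Continuous.continuousOn
    have : 0 ≤ β + 1 - 1 := by linarith
    exact (continuous_const.sub continuous_id).rpow_const (fun _ => Or.inr this)
  have := intervalIntegral.continuousOn_primitive_interval' h Set.left_mem_uIcc
  rw [Set.uIcc_of_le zero_le_one] at this
  exact this

/-- Continuous extension of the incomplete beta function. -/
def extB (β x : ℝ) : ℝ := incBeta β (β + 1) (max 0 (min x 1))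

lemma extB_cont (β : ℝ) (hβ : 0 < β) : Continuous (extB β) := by
  apply (aux_incBeta_cont β hβ).comp_continuous (by fun_prop)
  intro x
  exact ⟨le_max_left _ _, max_le zero_le_one (min_le_right _ _)⟩

lemma extB_eq (β s w : ℝ) (hs : 0 ≤ s) (hw : s ≤ w) :
    incBeta β (β + 1) (s / w) = extB β (s / w) := by
  have h1 : s / w ≤ 1 := div_le_one_of_le₀ hw (hs.trans hw)
  have h0 : 0 ≤ s / w := div_nonneg hs (hs.trans hw)
  rw [extB, min_eq_left h1, max_eq_right h0]

lemma extB_bdd (β : ℝ) (hβ : 0 < β) : ∃ C, 0 ≤ C ∧ ∀ x, |extB β x| ≤ C := by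
  obtain ⟨C, hC⟩ := isCompact_Icc.exists_bound_of_continuousOn (aux_incBeta_cont β hβ)
  have hx : ∀ x, |extB β x| ≤ C := fun x =>
    hC _ ⟨le_max_left _ _, max_le zero_le_one (min_le_right _ _)⟩
  exact ⟨C, (abs_nonneg _).trans (hx 0), hx⟩

lemma aux_inner_int (α β t s : ℝ) (hα : 0 < α) (hβ : 0 < β) (hs : 0 < s) (hst : s ≤ t) :
    IntervalIntegrable (fun w => (t - w) ^ (α - 1) *
      (w ^ (2 * β) * incBeta β (β + 1) (s / w))) volume s t := by
  apply (aux_int_sub α t s t hα).mul_continuousOn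
  rw [Set.uIcc_of_le hst]
  apply ContinuousOn.mul
  · exact (Real.continuous_rpow_const (by linarith)).continuousOn
  · apply ContinuousOn.congr (f := fun w => extB β (s / w))
    · apply (extB_cont β hβ).comp_continuousOn
      apply continuousOn_const.div continuousOn_id
      intro w hw
      exact (hs.trans_le hw.1).ne'
    · intro w hw
      exact extB_eq β s w hs.le hw.1

lemma aux_M_meas (α β t : ℝ) (hβ : 0 < β) :
    StronglyMeasurable (fun s => ∫ w, Set.indicator {p : ℝ × ℝ | p.1 < p.2 ∧ p.2 ≤ t}
      (fun p => (t - p.2) ^ (α - 1) * (p.2 ^ (2 * β) * extB β (p.1 / p.2))) (s, w)) := by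
  have hm : StronglyMeasurable (Set.indicator {p : ℝ × ℝ | p.1 < p.2 ∧ p.2 ≤ t}
      (fun p => (t - p.2) ^ (α - 1) * (p.2 ^ (2 * β) * extB β (p.1 / p.2)))) := by
    apply Measurable.stronglyMeasurable
    apply Measurable.indicator
    · have := (extB_cont β hβ).measurable
      have h3 : Measurable (fun p : ℝ × ℝ => extB β (p.1 / p.2)) :=
        this.comp (measurable_fst.div measurable_snd)
      fun_prop
    · exact (measurableSet_lt measurable_fst measurable_snd).inter
        (measurableSet_le measurable_snd measurable_const)
  exact hm.integral_prod_right'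

lemma aux_M_eq (α β t s : ℝ) (hs : 0 < s) (hst : s ≤ t) :
    (∫ w, Set.indicator {p : ℝ × ℝ | p.1 < p.2 ∧ p.2 ≤ t}
      (fun p => (t - p.2) ^ (α - 1) * (p.2 ^ (2 * β) * extB β (p.1 / p.2))) (s, w)) =
    ∫ w in s..t, (t - w) ^ (α - 1) * (w ^ (2 * β) * incBeta β (β + 1) (s / w)) := by
  rw [intervalIntegral.integral_of_le hst, ← integral_indicator measurableSet_Ioc]
  congr 1
  ext w
  by_cases hw : w ∈ Set.Ioc s t
  · rw [Set.indicator_of_mem hw, Set.indicator_of_mem (by exact hw), extB_eq β s w hs.le hw.1.le]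
  · rw [Set.indicator_of_notMem hw, Set.indicator_of_notMem (by exact hw)]

lemma aux_J_int (α β t : ℝ) (hα : 0 < α) (hβ : 0 < β) (ht : 0 < t) :
    IntervalIntegrable (fun s => (t - s) ^ (α - 1) *
      ∫ w in s..t, (t - w) ^ (α - 1) * (w ^ (2 * β) * incBeta β (β + 1) (s / w)))
      volume 0 t := by
  obtain ⟨C, hC0, hC⟩ := extB_bdd β hβ
  have h1 := aux_int_sub α t 0 t hα
  rw [intervalIntegrable_iff_integrableOn_Ioc_of_le ht.le] at h1 ⊢
  apply Integrable.mul_bdd (c := t ^ α / α * (t ^ (2 * β) * C)) h1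
  · apply (aux_M_meas α β t hβ).aestronglyMeasurable.congr
    filter_upwards [ae_restrict_mem measurableSet_Ioc] with s hs
    exact aux_M_eq α β t s hs.1 hs.2
  · filter_upwards [ae_restrict_mem measurableSet_Ioc] with s hs
    have hb := intervalIntegral.norm_integral_le_of_norm_le (μ := volume) hs.2
      (f := fun w => (t - w) ^ (α - 1) * (w ^ (2 * β) * incBeta β (β + 1) (s / w)))
      (g := fun w => (t - w) ^ (α - 1) * (t ^ (2 * β) * C)) ?_
      ((aux_int_sub α t s t hα).mul_const _)
    · rw [intervalIntegral.integral_mul_const, aux_inner α t s hα] at hb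
      refine hb.trans ?_
      have : (t - s) ^ α ≤ t ^ α :=
        Real.rpow_le_rpow (by linarith [hs.2]) (by linarith [hs.1]) hα.le
      gcongr
    · refine Filter.Eventually.of_forall fun w hw => ?_
      have hw0 : 0 < w := hs.1.trans hw.1
      have p1 : 0 ≤ (t - w) ^ (α - 1) := Real.rpow_nonneg (by linarith [hw.2]) _
      have p2 : 0 ≤ w ^ (2 * β) := Real.rpow_nonneg hw0.le _
      have p3 : w ^ (2 * β) ≤ t ^ (2 * β) := Real.rpow_le_rpow hw0.le hw.2 (by linarith)
      rw [extB_eq β s w hs.1.le hw.1.le, Real.norm_eq_abs, abs_mul, abs_mul, abs_of_nonneg p1,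
        abs_of_nonneg p2]
      have := hC (s / w)
      gcongr

lemma aux_A_int (α b t : ℝ) (hα : 0 < α) (hb : 0 < b) :
    IntervalIntegrable (fun s => (t - s) ^ (α - 1) * (t - s) ^ α * s ^ b) volume 0 t := by
  have h1 : Continuous (fun s : ℝ => (t - s) ^ α) :=
    (continuous_const.sub continuous_id).rpow_const (fun _ => Or.inr hα.le)
  exact ((aux_int_sub α t 0 t hα).mul_continuousOn h1.continuousOn).mul_continuousOn
    (Real.continuous_rpow_const hb.le).continuousOn

lemma aux_main (α β t p q r : ℝ) (hα : 0 < α) (hβ : 0 < β) (ht : 0 < t) :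
    (∫ s in (0 : ℝ)..t, ∫ w in s..t, (t - s) ^ (α - 1) * (t - w) ^ (α - 1) *
      (p * s ^ β + q * s ^ (2 * β) + r * (w ^ (2 * β) * incBeta β (β + 1) (s / w)))) =
    p / α * (t ^ (2 * α + β) * betaFn (β + 1) (2 * α)) +
    q / α * (t ^ (2 * α + 2 * β) * betaFn (2 * β + 1) (2 * α)) +
    r * ∫ s in (0 : ℝ)..t, ∫ w in s..t,
      (t - s) ^ (α - 1) * (t - w) ^ (α - 1) * w ^ (2 * β) * incBeta β (β + 1) (s / w) := by
  have hJ : ∀ s, (∫ w in s..t,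
      (t - s) ^ (α - 1) * (t - w) ^ (α - 1) * w ^ (2 * β) * incBeta β (β + 1) (s / w)) =
      (t - s) ^ (α - 1) *
      ∫ w in s..t, (t - w) ^ (α - 1) * (w ^ (2 * β) * incBeta β (β + 1) (s / w)) := by
    intro s
    rw [← intervalIntegral.integral_const_mul]
    congr 1; ext w; ring
  simp_rw [hJ]
  rw [← aux_beta α β t ht, ← aux_beta α (2 * β) t ht]
  have i1 := (aux_A_int α β t hα hβ).const_mul (p / α)
  have i2 := (aux_A_int α (2 * β) t hα (by linarith)).const_mul (q / α)
  have i3 := (aux_J_int α β t hα hβ ht).const_mul r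
  rw [← intervalIntegral.integral_const_mul, ← intervalIntegral.integral_const_mul,
    ← intervalIntegral.integral_const_mul, ← intervalIntegral.integral_add i1 i2,
    ← intervalIntegral.integral_add (i1.add i2) i3]
  apply intervalIntegral.integral_congr_Ioo_of_le ht.le
  intro s hs
  have j1 := (aux_int_sub α t s t hα).const_mul
    ((t - s) ^ (α - 1) * (p * s ^ β + q * s ^ (2 * β)))
  have j2 := (aux_inner_int α β t s hα hβ hs.1 hs.2.le).const_mul ((t - s) ^ (α - 1) * r)
  have e : ∀ w, (t - s) ^ (α - 1) * (t - w) ^ (α - 1) *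
      (p * s ^ β + q * s ^ (2 * β) + r * (w ^ (2 * β) * incBeta β (β + 1) (s / w))) =
      (t - s) ^ (α - 1) * (p * s ^ β + q * s ^ (2 * β)) * (t - w) ^ (α - 1) +
      (t - s) ^ (α - 1) * r * ((t - w) ^ (α - 1) *
        (w ^ (2 * β) * incBeta β (β + 1) (s / w))) := by
    intro w; ring
  simp only [e]
  rw [intervalIntegral.integral_add j1 j2, intervalIntegral.integral_const_mul,
    intervalIntegral.integral_const_mul, aux_inner α t s hα]
  ring

theorem gfcp_fracint_var (k : ℕ) (hk : 1 ≤ k) (l : Fin k → ℝ) (hl : ∀ j, 0 < l j)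
    (c₁ c₂ : ℝ) (hc₁ : c₁ = ∑ j, (j.val + 1 : ℝ) * l j)
    (hc₂ : c₂ = ∑ j, ((j.val + 1 : ℝ)) ^ 2 * l j)
    (α β t : ℝ) (hα : 0 < α) (hβ : 0 < β) (hβ1 : β < 1) (ht : 0 < t) :
    (2 / (Real.Gamma α) ^ 2) *
        (∫ s in (0 : ℝ)..t, ∫ w in s..t,
          (t - s) ^ (α - 1) * (t - w) ^ (α - 1) *
            (c₂ * s ^ β / Real.Gamma (β + 1) + c₁ ^ 2 * s ^ (2 * β) / Real.Gamma (2 * β + 1) +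
              c₁ ^ 2 * β * w ^ (2 * β) * incBeta β (β + 1) (s / w) / (Real.Gamma (β + 1)) ^ 2)) -
        (c₁ * t ^ (α + β) / Real.Gamma (α + β + 1)) ^ 2 =
      (2 * c₂ * betaFn (β + 1) (2 * α) / ((Real.Gamma α) ^ 2 * Real.Gamma (β + 1) * α)) *
          t ^ (2 * α + β) +
        (2 * betaFn (2 * β + 1) (2 * α) / ((Real.Gamma α) ^ 2 * Real.Gamma (2 * β + 1) * α) -
            1 / (Real.Gamma (α + β + 1)) ^ 2) * c₁ ^ 2 * t ^ (2 * α + 2 * β) +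
        (2 * c₁ ^ 2 * β / (Real.Gamma α * Real.Gamma (β + 1)) ^ 2) *
          ∫ s in (0 : ℝ)..t, ∫ w in s..t,
            (t - s) ^ (α - 1) * (t - w) ^ (α - 1) * w ^ (2 * β) * incBeta β (β + 1) (s / w) := by
  have h := aux_main α β t (c₂ / Real.Gamma (β + 1)) (c₁ ^ 2 / Real.Gamma (2 * β + 1))
    (c₁ ^ 2 * β / (Real.Gamma (β + 1)) ^ 2) hα hβ ht
  have e : ∀ s w : ℝ, c₂ * s ^ β / Real.Gamma (β + 1) +
      c₁ ^ 2 * s ^ (2 * β) / Real.Gamma (2 * β + 1) +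
      c₁ ^ 2 * β * w ^ (2 * β) * incBeta β (β + 1) (s / w) / (Real.Gamma (β + 1)) ^ 2 =
      c₂ / Real.Gamma (β + 1) * s ^ β + c₁ ^ 2 / Real.Gamma (2 * β + 1) * s ^ (2 * β) +
      c₁ ^ 2 * β / (Real.Gamma (β + 1)) ^ 2 *
        (w ^ (2 * β) * incBeta β (β + 1) (s / w)) := by
    intro s w; ring
  simp only [e]
  rw [h]
  have e2 : t ^ (2 * α + 2 * β) = (t ^ (α + β)) ^ 2 := by
    rw [← Real.rpow_natCast, ← Real.rpow_mul ht.le]; congr 1; push_cast; ring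
  rw [e2]
  ring
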